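/- (Comparison of Y-derivatives with X-derivatives up to order N+1.) Fix integers n ≥ 2, m ≥ 1, N ≥ 1, let M be an integer with 1 ≤ M ≤ N+1 and let p ∈ (1,∞). Then there exists a constant c > 0 such that for every φ ∈ C_c^∞(ℝ^(n+m)) and every word α ∈ {1,…,n+m}^M one has ‖Y^α φ‖_p ≤ c · max_{β} ‖X^β φ‖_p, where the maximum is over all words β of elements of 𝒳 with |β| = M. -/

import Mathlib

open MeasureTheory
open scoped ENNReal NNReal

/-- Points of `ℝ^(n+m)`, written `(x, y)` with `x ∈ ℝⁿ`, `y ∈ ℝᵐ`. -/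
abbrev Pt (n m : ℕ) := (Fin n → ℝ) × (Fin m → ℝ)

/-- The partial derivative operator `∂_{x_j}`. -/
noncomputable def Dx (n m : ℕ) (j : Fin n) (f : Pt n m → ℝ) : Pt n m → ℝ :=
  fun z => fderiv ℝ f z (Pi.single j 1, 0)

/-- The partial derivative operator `∂_{y_k}`. -/
noncomputable def Dy (n m : ℕ) (k : Fin m) (f : Pt n m → ℝ) : Pt n m → ℝ :=
  fun z => fderiv ℝ f z (0, Pi.single k 1)

/-- Index set for the family `𝒳`: either `j ∈ {1,…,n}` (giving `X_j = ∂_{x_j}`) or a pair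
of a multi-index `ν ∈ ℕⁿ` with `|ν| = N` and `k ∈ {1,…,m}` (giving
`X_{ν,k} = (N!/ν!)^(1/2) x^ν ∂_{y_k}`). -/
def XIdx (n m N : ℕ) := Fin n ⊕ ({ν : Fin n → ℕ // ∑ i, ν i = N} × Fin m)

/-- The family `𝒳` of first-order operators `X_j = ∂_{x_j}` and
`X_{ν,k} = (N!/ν!)^(1/2) x^ν ∂_{y_k}` for `|ν| = N`. -/
noncomputable def Xop (n m N : ℕ) : XIdx n m N → (Pt n m → ℝ) → (Pt n m → ℝ)
  | Sum.inl j => Dx n m j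
  | Sum.inr (ν, k) => fun f z =>
      Real.sqrt ((Nat.factorial N : ℝ) / ∏ i, (Nat.factorial (ν.1 i) : ℝ)) *
        (∏ i, z.1 i ^ ν.1 i) * Dy n m k f z

/-- Composition `Z_1 ∘ Z_2 ∘ ⋯ ∘ Z_s` of a word of operators. -/
def compOps {n m : ℕ} (l : List ((Pt n m → ℝ) → (Pt n m → ℝ))) :
    (Pt n m → ℝ) → (Pt n m → ℝ) :=
  l.foldr (· ∘ ·) id

/-- `X^α` for a word `α` of elements of `𝒳`. -/
noncomputable def Xw {n m N M : ℕ} (α : Fin M → XIdx n m N) :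
    (Pt n m → ℝ) → (Pt n m → ℝ) :=
  compOps (List.ofFn fun i => Xop n m N (α i))

/-- The Gru\v{s}in operator `H_N = −Δ_x − |x|^(2N) Δ_y`. -/
noncomputable def grusin (n m N : ℕ) (f : Pt n m → ℝ) : Pt n m → ℝ :=
  fun z => -(∑ j, Dx n m j (Dx n m j f) z) -
    (∑ i, z.1 i ^ 2) ^ N * ∑ k, Dy n m k (Dy n m k f) z

/-- The operators `Y_j = ∂_{x_j}` for `j ≤ n` and `Y_{n+l} = |x|^N ∂_{y_l}` for `l ≤ m`. -/
noncomputable def Yop (n m N : ℕ) : (Fin n ⊕ Fin m) → (Pt n m → ℝ) → (Pt n m → ℝ)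
  | Sum.inl j => Dx n m j
  | Sum.inr l => fun f z => Real.sqrt (∑ i, z.1 i ^ 2) ^ N * Dy n m l f z

/-- `Y^α` for a word `α ∈ {1,…,n+m}^M`. -/
noncomputable def Yw {n m N M : ℕ} (α : Fin M → (Fin n ⊕ Fin m)) :
    (Pt n m → ℝ) → (Pt n m → ℝ) :=
  compOps (List.ofFn fun i => Yop n m N (α i))


section SmoothAlgebra

variable {E : Type*} [NormedAddCommGroup E] [NormedSpace ℝ E]

/-- The algebra of smooth real-valued functions on `E`. -/
def smoothAlg (E : Type*) [NormedAddCommGroup E] [NormedSpace ℝ E] : Subalgebra ℝ (E → ℝ) where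
  carrier := {f | ContDiff ℝ (⊤ : ℕ∞) f}
  mul_mem' := fun {f g} (hf : ContDiff ℝ _ f) (hg : ContDiff ℝ _ g) =>
    show ContDiff ℝ (⊤ : ℕ∞) fun z => f z * g z from hf.mul hg
  add_mem' := fun {f g} (hf : ContDiff ℝ _ f) (hg : ContDiff ℝ _ g) =>
    show ContDiff ℝ (⊤ : ℕ∞) fun z => f z + g z from hf.add hg
  algebraMap_mem' := fun c =>
    show ContDiff ℝ (⊤ : ℕ∞) fun _ : E => c from contDiff_const

theorem smoothAlg.contDiff (f : smoothAlg E) : ContDiff ℝ (⊤ : ℕ∞) (f : E → ℝ) := f.2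

theorem smoothAlg.differentiable (f : smoothAlg E) : Differentiable ℝ (f : E → ℝ) :=
  (smoothAlg.contDiff f).differentiable (by simp)

/-- The directional derivative along `v`, as a derivation of the algebra of smooth functions. -/
noncomputable def dirDeriv (v : E) : Derivation ℝ (smoothAlg E) (smoothAlg E) :=
  Derivation.mk'
    { toFun := fun f => ⟨fun z => fderiv ℝ (f : E → ℝ) z v,
        ((smoothAlg.contDiff f).fderiv_right (m := (⊤ : ℕ∞)) (by simp)).clm_apply contDiff_const⟩
      map_add' := fun f g => by
        ext z
        change fderiv ℝ ((f : E → ℝ) + (g : E → ℝ)) z v = _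
        rw [fderiv_add (smoothAlg.differentiable f z) (smoothAlg.differentiable g z)]
        rfl
      map_smul' := fun c f => by
        ext z
        change fderiv ℝ (c • (f : E → ℝ)) z v = _
        rw [fderiv_const_smul (smoothAlg.differentiable f z)]
        rfl }
    (fun f g => by
      ext z
      change fderiv ℝ ((f : E → ℝ) * (g : E → ℝ)) z v = _
      rw [fderiv_mul (smoothAlg.differentiable f z) (smoothAlg.differentiable g z)]
      rfl)

theorem dirDeriv_apply (v : E) (f : smoothAlg E) (z : E) :
    (dirDeriv v f : E → ℝ) z = fderiv ℝ (f : E → ℝ) z v := rfl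

/-- The directional derivative along `v`, as a linear endomorphism. -/
noncomputable def dirEnd (v : E) : Module.End ℝ (smoothAlg E) := (dirDeriv v).toLinearMap

theorem dirEnd_apply (v : E) (f : smoothAlg E) : dirEnd v f = dirDeriv v f := rfl

theorem commute_dirEnd (v w : E) : Commute (dirEnd v) (dirEnd w) := by
  have key : ∀ (a b : E) (f : smoothAlg E) (z : E),
      (dirDeriv a (dirDeriv b f) : E → ℝ) z = fderiv ℝ (fderiv ℝ (f : E → ℝ)) z a b := by
    intro a b f z
    rw [dirDeriv_apply]
    change fderiv ℝ (fun z => fderiv ℝ (f : E → ℝ) z b) z a = _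
    have hd : DifferentiableAt ℝ (fderiv ℝ (f : E → ℝ)) z :=
      ((smoothAlg.contDiff f).fderiv_right (m := (⊤ : ℕ∞)) (by simp)).differentiable (by simp) z
    rw [fderiv_clm_apply hd (differentiableAt_const b)]
    simp
  ext f z
  change (dirDeriv v (dirDeriv w f) : E → ℝ) z = (dirDeriv w (dirDeriv v f) : E → ℝ) z
  rw [key, key]
  exact ((smoothAlg.contDiff f).contDiffAt.isSymmSndFDerivAt (by
    rw [minSmoothness_of_isRCLikeNormedField]; exact WithTop.coe_le_coe.2 le_top)) v w

theorem dirEnd_mul_lmul (v : E) (g : smoothAlg E) :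
    dirEnd v * Algebra.lmul ℝ (smoothAlg E) g =
      Algebra.lmul ℝ (smoothAlg E) g * dirEnd v +
        Algebra.lmul ℝ (smoothAlg E) (dirDeriv v g) := by
  ext1 f
  change dirDeriv v (g * f) = g * dirDeriv v f + dirDeriv v g * f
  rw [Derivation.leibniz, smul_eq_mul, smul_eq_mul, mul_comm f]

end SmoothAlgebra

section Generators

variable {n m N : ℕ}

/-- `∂_{x_j}` on smooth functions. -/
noncomputable def xEnd (m : ℕ) {n : ℕ} (j : Fin n) : Module.End ℝ (smoothAlg (Pt n m)) :=
  dirEnd (Pi.single j 1, 0)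

/-- `∂_{y_k}` on smooth functions. -/
noncomputable def yEnd (n : ℕ) {m : ℕ} (k : Fin m) : Module.End ℝ (smoothAlg (Pt n m)) :=
  dirEnd (0, Pi.single k 1)

/-- The coordinate function `x_i`. -/
def xCoord (m : ℕ) {n : ℕ} (i : Fin n) : smoothAlg (Pt n m) :=
  ⟨fun z => z.1 i, show ContDiff ℝ (⊤ : ℕ∞) fun z : Pt n m => z.1 i by fun_prop⟩

/-- Multiplication by `x_i`. -/
noncomputable def xMul (m : ℕ) {n : ℕ} (i : Fin n) : Module.End ℝ (smoothAlg (Pt n m)) :=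
  Algebra.lmul ℝ _ (xCoord m i)

theorem dirDeriv_xCoord (v : Pt n m) (i : Fin n) :
    dirDeriv v (xCoord m i) = algebraMap ℝ _ (v.1 i) := by
  ext z
  rw [dirDeriv_apply]
  have h : HasFDerivAt (xCoord m i : Pt n m → ℝ)
      ((ContinuousLinearMap.proj (R := ℝ) (φ := fun _ : Fin n => ℝ) i).comp
        (ContinuousLinearMap.fst ℝ (Fin n → ℝ) (Fin m → ℝ))) z :=
    ((ContinuousLinearMap.proj (R := ℝ) (φ := fun _ : Fin n => ℝ) i).comp
      (ContinuousLinearMap.fst ℝ (Fin n → ℝ) (Fin m → ℝ))).hasFDerivAt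
  rw [h.fderiv]
  rfl

theorem xMul_pow_apply (i : Fin n) (d : ℕ) (f : smoothAlg (Pt n m)) (z : Pt n m) :
    ((xMul m i ^ d) f : Pt n m → ℝ) z = z.1 i ^ d * (f : Pt n m → ℝ) z := by
  rw [xMul, ← map_pow]
  rfl

theorem commute_xMul_yEnd (i : Fin n) (k : Fin m) : Commute (xMul m i) (yEnd n k) := by
  have h := dirEnd_mul_lmul ((0, Pi.single k 1) : Pt n m) (xCoord m i)
  rw [dirDeriv_xCoord] at h
  simp only [Pi.zero_apply, map_zero, add_zero] at h
  exact h.symm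

theorem xEnd_mul_xMul_pow (i : Fin n) (d : ℕ) :
    xEnd m i * xMul m i ^ (d + 1) =
      xMul m i ^ (d + 1) * xEnd m i + ((d : ℝ) + 1) • xMul m i ^ d := by
  have h := dirEnd_mul_lmul ((Pi.single i 1, 0) : Pt n m) (xCoord m i ^ (d + 1))
  rw [Derivation.leibniz_pow, dirDeriv_xCoord] at h
  simp only [Pi.single_eq_same, map_one, Nat.add_sub_cancel, smul_eq_mul, mul_one] at h
  rw [map_pow, ← Nat.cast_smul_eq_nsmul ℝ, map_smul, map_pow] at h
  rw [xMul, xEnd, h]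
  push_cast
  rfl

/-- The operators of the family `𝒳` acting on smooth functions. -/
noncomputable def genEnd (n m N : ℕ) : XIdx n m N → Module.End ℝ (smoothAlg (Pt n m))
  | Sum.inl j => xEnd m j
  | Sum.inr (ν, k) =>
      Real.sqrt ((Nat.factorial N : ℝ) / ∏ i, (Nat.factorial (ν.1 i) : ℝ)) •
        (Algebra.lmul ℝ _ (∏ i, xCoord m i ^ ν.1 i) * yEnd n k)

theorem genEnd_apply (q : XIdx n m N) (f : smoothAlg (Pt n m)) :
    (genEnd n m N q f : Pt n m → ℝ) = Xop n m N q f := by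
  rcases q with j | ⟨ν, k⟩
  · rfl
  · ext z
    change _ * (((∏ i, xCoord m i ^ ν.1 i : smoothAlg (Pt n m)) : Pt n m → ℝ) z * _) = _ * _ * _
    rw [mul_assoc]
    congr 2
    simp only [SubmonoidClass.coe_finsetProd, Finset.prod_apply, SubmonoidClass.coe_pow,
      Pi.pow_apply]
    rfl

theorem genEnd_prod_apply (l : List (XIdx n m N)) (f : smoothAlg (Pt n m)) :
    ((l.map (genEnd n m N)).prod f : Pt n m → ℝ) = compOps (l.map (Xop n m N)) f := by
  induction l with
  | nil => rfl
  | cons q l ih =>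
    rw [List.map_cons, List.prod_cons, Module.End.mul_apply, genEnd_apply, ih]
    rfl

/-- The span of the operators of the family `𝒳`. -/
noncomputable def genSpan (n m N : ℕ) : Submodule ℝ (Module.End ℝ (smoothAlg (Pt n m))) :=
  Submodule.span ℝ (Set.range (genEnd n m N))

theorem xEnd_mem (j : Fin n) : xEnd m j ∈ genSpan n m N :=
  Submodule.subset_span ⟨Sum.inl j, rfl⟩

theorem xMul_pow_mul_yEnd_mem (i : Fin n) (k : Fin m) :
    xMul m i ^ N * yEnd n k ∈ genSpan n m N := by
  refine Submodule.subset_span ⟨Sum.inr (⟨Pi.single i N, by simp⟩, k), ?_⟩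
  have h1 : ∏ j, ((Nat.factorial ((Pi.single i N : Fin n → ℕ) j) : ℕ) : ℝ) = Nat.factorial N := by
    rw [Finset.prod_eq_single i (fun j _ hj => by simp [Pi.single_eq_of_ne hj]) (by simp)]
    simp
  have h2 : ∏ j, xCoord m j ^ (Pi.single i N : Fin n → ℕ) j = xCoord m i ^ N := by
    rw [Finset.prod_eq_single i (fun j _ hj => by simp [Pi.single_eq_of_ne hj]) (by simp)]
    simp
  simp only [genEnd]
  rw [h1, h2, div_self (by positivity), Real.sqrt_one, one_smul, map_pow]
  rfl

theorem xMul_pow_mul_yEnd_mem_pow (i : Fin n) (k : Fin m) {d s : ℕ} (h : d + s = N) :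
    xMul m i ^ d * yEnd n k ∈ genSpan n m N ^ (s + 1) := by
  induction s generalizing d with
  | zero =>
    obtain rfl : d = N := h
    simpa using xMul_pow_mul_yEnd_mem (m := m) (N := d) i k
  | succ s ih =>
    have hA := ih (d := d + 1) (by omega)
    have h1 := Submodule.mul_mem_mul (xEnd_mem (m := m) (N := N) i) hA
    have h2 := Submodule.mul_mem_mul hA (xEnd_mem (m := m) (N := N) i)
    rw [← pow_succ'] at h1
    rw [← pow_succ] at h2
    have hc : yEnd n k * xEnd m i = xEnd m i * yEnd n k := commute_dirEnd _ _
    have hneg : ∀ T : Module.End ℝ (smoothAlg (Pt n m)), T + (-1 : ℝ) • T = 0 := fun T => by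
      ext1 f
      simp
    have h3 : ((d : ℝ) + 1) • (xMul m i ^ d * yEnd n k) =
        xEnd m i * (xMul m i ^ (d + 1) * yEnd n k) +
          (-1 : ℝ) • (xMul m i ^ (d + 1) * yEnd n k * xEnd m i) := by
      rw [← mul_assoc, xEnd_mul_xMul_pow, mul_assoc _ (yEnd n k), hc, add_mul, smul_mul_assoc,
        mul_assoc, add_right_comm, hneg, zero_add]
    rw [← Submodule.smul_mem_iff _ (show ((d : ℝ) + 1) ≠ 0 by positivity), h3]
    exact Submodule.add_mem _ h1 (Submodule.smul_mem _ _ h2)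

/-- The operator `∂_y^λ ∂_x^σ`. -/
noncomputable def yxEnd (l : List (Fin m)) (s : List (Fin n)) :
    Module.End ℝ (smoothAlg (Pt n m)) :=
  (l.map (yEnd n)).prod * (s.map (xEnd m)).prod

theorem yEnd_mul_yxEnd (k : Fin m) (l : List (Fin m)) (s : List (Fin n)) :
    yEnd n k * yxEnd l s = yxEnd (k :: l) s := by
  simp [yxEnd, mul_assoc]

theorem xEnd_mul_yxEnd (j : Fin n) (l : List (Fin m)) (s : List (Fin n)) :
    xEnd m j * yxEnd l s = yxEnd l (j :: s) := by
  have h : Commute (xEnd m j) (l.map (yEnd n)).prod := by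
    refine Commute.list_prod_right _ _ fun T hT => ?_
    obtain ⟨k, -, rfl⟩ := List.mem_map.1 hT
    exact commute_dirEnd _ _
  simp only [yxEnd, List.map_cons, List.prod_cons]
  rw [← mul_assoc, h.eq, mul_assoc]

theorem xEnd_prod_mem (s : List (Fin n)) :
    (s.map (xEnd m)).prod ∈ genSpan n m N ^ s.length := by
  induction s with
  | nil => simp
  | cons j s ih =>
    rw [List.map_cons, List.prod_cons, List.length_cons, pow_succ']
    exact Submodule.mul_mem_mul (xEnd_mem j) ih

theorem xMul_pow_mul_yEnd_prod_mem (i : Fin n) (l : List (Fin m)) :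
    xMul m i ^ (l.length * N) * (l.map (yEnd n)).prod ∈ genSpan n m N ^ l.length := by
  induction l with
  | nil => simp
  | cons k l ih =>
    have hc : Commute (xMul m i ^ (l.length * N)) (yEnd n k) :=
      (commute_xMul_yEnd i k).pow_left _
    have := Submodule.mul_mem_mul (xMul_pow_mul_yEnd_mem (N := N) i k) ih
    rw [List.map_cons, List.prod_cons, List.length_cons, pow_succ']
    convert this using 1
    rw [add_mul, one_mul, add_comm, pow_add, mul_assoc, mul_assoc, ← mul_assoc _ (yEnd n k), hc.eq,
      mul_assoc]

theorem xMul_pow_mul_yxEnd_mem (i : Fin n) {l : List (Fin m)} (hl : l ≠ []) (s : List (Fin n))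
    {d t : ℕ} (ht : t ≤ N) (hd : d + t = l.length * N) :
    xMul m i ^ d * yxEnd l s ∈ genSpan n m N ^ (l.length + t + s.length) := by
  obtain ⟨k, l, rfl⟩ := List.exists_cons_of_ne_nil hl
  have hd' : d = (N - t) + l.length * N := by
    rw [List.length_cons, add_mul, one_mul] at hd
    omega
  have hc : Commute (xMul m i ^ (l.length * N)) (yEnd n k) :=
    (commute_xMul_yEnd i k).pow_left _
  have h := Submodule.mul_mem_mul (Submodule.mul_mem_mul
    (xMul_pow_mul_yEnd_mem_pow i k (Nat.sub_add_cancel ht)) (xMul_pow_mul_yEnd_prod_mem (N := N) i l))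
    (xEnd_prod_mem (m := m) (N := N) s)
  rw [← pow_add, ← pow_add] at h
  convert h using 1
  · rw [List.length_cons]
    congr 1
    omega
  · rw [yxEnd, List.map_cons, List.prod_cons, hd', pow_add]
    simp only [mul_assoc]
    rw [← mul_assoc _ (yEnd n k), hc.eq, mul_assoc]

theorem exists_eLpNorm_le_iSup_Xw {M : ℕ} {S : Module.End ℝ (smoothAlg (Pt n m))}
    (hS : S ∈ genSpan n m N ^ M) {p : ℝ≥0∞} (hp : 1 ≤ p) :
    ∃ C : ℝ≥0, ∀ f : smoothAlg (Pt n m), eLpNorm (S f : Pt n m → ℝ) p volume ≤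
      C * ⨆ β : Fin M → XIdx n m N, eLpNorm (Xw β (f : Pt n m → ℝ)) p volume := by
  rw [genSpan, Submodule.span_pow] at hS
  induction hS using Submodule.span_induction with
  | mem T hT =>
    obtain ⟨g, rfl⟩ := Set.mem_pow.1 hT
    choose β hβ using fun i => (g i).2
    refine ⟨1, fun f => ?_⟩
    have h : (List.ofFn fun i => (g i : Module.End ℝ (smoothAlg (Pt n m)))) =
        (List.ofFn β).map (genEnd n m N) := by
      rw [List.map_ofFn]
      exact congrArg List.ofFn (funext fun i => (hβ i).symm)
    rw [h, genEnd_prod_apply, List.map_ofFn, ENNReal.coe_one, one_mul]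
    exact le_iSup (fun β : Fin M → XIdx n m N => eLpNorm (Xw β (f : Pt n m → ℝ)) p volume) β
  | zero => exact ⟨0, fun f => by simp⟩
  | add S T _ _ ihS ihT =>
    obtain ⟨C, hC⟩ := ihS
    obtain ⟨D, hD⟩ := ihT
    refine ⟨C + D, fun f => ?_⟩
    rw [ENNReal.coe_add, add_mul]
    exact (eLpNorm_add_le (smoothAlg.contDiff (S f)).continuous.aestronglyMeasurable
      (smoothAlg.contDiff (T f)).continuous.aestronglyMeasurable hp).trans
      (add_le_add (hC f) (hD f))
  | smul c S _ ih =>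
    obtain ⟨C, hC⟩ := ih
    refine ⟨‖c‖₊ * C, fun f => ?_⟩
    change eLpNorm (c • (S f : Pt n m → ℝ)) p volume ≤ _
    rw [eLpNorm_const_smul, ENNReal.coe_mul, mul_assoc]
    exact mul_le_mul_right (hC f) _

end Generators

section Coefficients

variable {n : ℕ}

/-- The Euclidean norm on `ℝⁿ`. -/
noncomputable def rad (x : Fin n → ℝ) : ℝ := Real.sqrt (∑ i, x i ^ 2)

theorem rad_pos {x : Fin n → ℝ} (hx : x ≠ 0) : 0 < rad x := by
  obtain ⟨i, hi⟩ := Function.ne_iff.1 hx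
  refine Real.sqrt_pos.2 (Finset.sum_pos' (fun i _ => sq_nonneg _) ⟨i, Finset.mem_univ i, ?_⟩)
  exact sq_pos_of_ne_zero hi

theorem abs_coord_le_rad (x : Fin n → ℝ) (i : Fin n) : |x i| ≤ rad x := by
  rw [← Real.sqrt_sq_eq_abs]
  exact Real.sqrt_le_sqrt
    (Finset.single_le_sum (f := fun i => x i ^ 2) (fun i _ => sq_nonneg _) (Finset.mem_univ i))

theorem exists_rad_le {x : Fin n → ℝ} (hx : x ≠ 0) : ∃ i, rad x ≤ n * |x i| := by
  obtain ⟨i₀, -⟩ := Function.ne_iff.1 hx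
  obtain ⟨i, -, hi⟩ := Finset.exists_max_image Finset.univ (fun i => |x i|) ⟨i₀, Finset.mem_univ _⟩
  have hn : (1 : ℝ) ≤ n := by
    exact_mod_cast (Nat.zero_le _).trans_lt i₀.isLt
  refine ⟨i, Real.sqrt_le_iff.2 ⟨by positivity, ?_⟩⟩
  calc ∑ j, x j ^ 2 ≤ ∑ _j : Fin n, |x i| ^ 2 :=
        Finset.sum_le_sum fun j _ => by
          rw [← sq_abs]
          exact pow_le_pow_left₀ (abs_nonneg _) (hi j (Finset.mem_univ j)) 2
    _ = n * |x i| ^ 2 := by simp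
    _ ≤ (n * |x i|) ^ 2 := by
        rw [mul_pow]
        exact mul_le_mul_of_nonneg_right (by nlinarith) (by positivity)

theorem hasFDerivAt_rad_zpow {x : Fin n → ℝ} (hx : x ≠ 0) (e : ℤ) :
    ∃ L : (Fin n → ℝ) →L[ℝ] ℝ, HasFDerivAt (fun x => rad x ^ e) L x ∧
      ∀ j, L (Pi.single j 1) = e * (x j * rad x ^ (e - 2)) := by
  have hr := rad_pos hx
  have h1 : HasFDerivAt (fun x : Fin n → ℝ => ∑ i, x i ^ 2)
      (∑ i, (2 * x i) • ContinuousLinearMap.proj (R := ℝ) (φ := fun _ : Fin n => ℝ) i) x := by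
    refine HasFDerivAt.fun_sum fun i _ => ?_
    have := (ContinuousLinearMap.proj (R := ℝ) (φ := fun _ : Fin n => ℝ) i).hasFDerivAt (x := x)
    simpa using this.pow 2
  have h2 := h1.sqrt (Real.sqrt_pos.1 hr).ne'
  have h3 := (hasDerivAt_zpow e (rad x) (Or.inl hr.ne')).comp_hasFDerivAt x h2
  refine ⟨_, h3, fun j => ?_⟩
  have h4 : (∑ i, (2 * x i) • ContinuousLinearMap.proj (R := ℝ) (φ := fun _ : Fin n => ℝ) i)
      (Pi.single j (1 : ℝ)) = 2 * x j := by
    simp [Pi.single_apply]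
  rw [smul_apply, smul_apply, h4]
  change (e * rad x ^ (e - 1)) * (1 / (2 * rad x) * (2 * x j)) = _
  rw [show e - 1 = e - 2 + 1 by ring, zpow_add_one₀ hr.ne']
  field_simp

/-- Functions on `ℝⁿ ∖ {0}` generated by constants, coordinates and powers of the Euclidean norm,
homogeneous of the given degree. -/
inductive HomCoef (n : ℕ) : ℤ → ((Fin n → ℝ) → ℝ) → Prop
  | const (c : ℝ) : HomCoef n 0 fun _ => c
  | coord (i : Fin n) : HomCoef n 1 fun x => x i
  | radPow (e : ℤ) : HomCoef n e fun x => rad x ^ e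
  | mul {d e f : ℤ} {a b : (Fin n → ℝ) → ℝ} (h : d + e = f) :
      HomCoef n d a → HomCoef n e b → HomCoef n f fun x => a x * b x
  | add {d : ℤ} {a b : (Fin n → ℝ) → ℝ} :
      HomCoef n d a → HomCoef n d b → HomCoef n d fun x => a x + b x

theorem HomCoef.exists_bound {d : ℤ} {a : (Fin n → ℝ) → ℝ} (ha : HomCoef n d a) :
    ∃ C : ℝ, 0 ≤ C ∧ ∀ x, x ≠ 0 → |a x| ≤ C * rad x ^ d := by
  induction ha with
  | const c => exact ⟨|c|, abs_nonneg c, fun x _ => by simp⟩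
  | coord i => exact ⟨1, zero_le_one, fun x _ => by simpa using abs_coord_le_rad x i⟩
  | radPow e =>
    refine ⟨1, zero_le_one, fun x hx => ?_⟩
    rw [abs_of_pos (zpow_pos (rad_pos hx) e), one_mul]
  | mul h _ _ iha ihb =>
    obtain ⟨C, hC0, hC⟩ := iha
    obtain ⟨D, hD0, hD⟩ := ihb
    refine ⟨C * D, mul_nonneg hC0 hD0, fun x hx => ?_⟩
    have hr := rad_pos hx
    rw [abs_mul, ← h, zpow_add₀ hr.ne', mul_mul_mul_comm]
    exact mul_le_mul (hC x hx) (hD x hx) (abs_nonneg _) (by positivity)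
  | add _ _ iha ihb =>
    obtain ⟨C, hC0, hC⟩ := iha
    obtain ⟨D, hD0, hD⟩ := ihb
    refine ⟨C + D, add_nonneg hC0 hD0, fun x hx => ?_⟩
    rw [add_mul]
    exact (abs_add_le _ _).trans (add_le_add (hC x hx) (hD x hx))

theorem HomCoef.differentiableAt {d : ℤ} {a : (Fin n → ℝ) → ℝ} (ha : HomCoef n d a)
    {x : Fin n → ℝ} (hx : x ≠ 0) : DifferentiableAt ℝ a x := by
  induction ha with
  | const c => fun_prop
  | coord i => fun_prop
  | radPow e =>
    obtain ⟨L, hL, -⟩ := hasFDerivAt_rad_zpow hx e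
    exact hL.differentiableAt
  | mul _ _ _ iha ihb => exact iha.mul ihb
  | add _ _ iha ihb => exact iha.add ihb

theorem HomCoef.exists_fderiv {d : ℤ} {a : (Fin n → ℝ) → ℝ} (ha : HomCoef n d a) (j : Fin n) :
    ∃ b, HomCoef n (d - 1) b ∧ ∀ x, x ≠ 0 → fderiv ℝ a x (Pi.single j 1) = b x := by
  induction ha with
  | const c =>
    refine ⟨fun x => 0 * rad x ^ (0 - 1 : ℤ), .mul (by ring) (.const 0) (.radPow _), fun x _ => ?_⟩
    simp
  | coord i =>
    refine ⟨_, .const ((Pi.single j 1 : Fin n → ℝ) i), fun x _ => ?_⟩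
    have := (ContinuousLinearMap.proj (R := ℝ) (φ := fun _ : Fin n => ℝ) i).hasFDerivAt (x := x)
    exact congrArg (fun L : (Fin n → ℝ) →L[ℝ] ℝ => L (Pi.single j 1)) this.fderiv
  | radPow e =>
    refine ⟨_, .mul (zero_add _) (.const (e : ℝ))
      (.mul (show 1 + (e - 2) = e - 1 by ring) (.coord j) (.radPow (e - 2))), fun x hx => ?_⟩
    obtain ⟨L, hL, h⟩ := hasFDerivAt_rad_zpow hx e
    rw [hL.fderiv, h]
  | @mul d e f a b hdef ha hb iha ihb =>
    obtain ⟨a', ha', hA⟩ := iha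
    obtain ⟨b', hb', hB⟩ := ihb
    refine ⟨_, .add (.mul (show d + (e - 1) = f - 1 by omega) ha hb')
      (.mul (show e + (d - 1) = f - 1 by omega) hb ha'), fun x hx => ?_⟩
    rw [fderiv_fun_mul (ha.differentiableAt hx) (hb.differentiableAt hx), ← hA x hx, ← hB x hx]
    rfl
  | add ha hb iha ihb =>
    obtain ⟨a', ha', hA⟩ := iha
    obtain ⟨b', hb', hB⟩ := ihb
    refine ⟨_, .add ha' hb', fun x hx => ?_⟩
    rw [fderiv_fun_add (ha.differentiableAt hx) (hb.differentiableAt hx), ← hA x hx, ← hB x hx]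
    rfl

end Coefficients

section YWords

variable {n m N : ℕ}

/-- Normal forms, away from `x = 0`, of words with `r` letters `|x|^N ∂_{y_l}` and `s` letters
`∂_{x_j}`. -/
inductive YForm (n m N : ℕ) : ℕ → ℕ → (smoothAlg (Pt n m) → Pt n m → ℝ) → Prop
  | pure (σ : List (Fin n)) :
      YForm n m N 0 σ.length fun f => ((σ.map (xEnd m)).prod f : Pt n m → ℝ)
  | term {r s : ℕ} {d : ℤ} {a : (Fin n → ℝ) → ℝ} (ha : HomCoef n d a) (l : List (Fin m))
      (σ : List (Fin n)) (hl : l ≠ []) (hr : l.length = r) (hs : σ.length ≤ s)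
      (hd : d = r * N - s + σ.length) :
      YForm n m N r s fun f z => a z.1 * (yxEnd l σ f : Pt n m → ℝ) z
  | add {r s : ℕ} {T U : smoothAlg (Pt n m) → Pt n m → ℝ} :
      YForm n m N r s T → YForm n m N r s U → YForm n m N r s fun f z => T f z + U f z

theorem YForm.differentiableAt {r s : ℕ} {T : smoothAlg (Pt n m) → Pt n m → ℝ}
    (hT : YForm n m N r s T) (f : smoothAlg (Pt n m)) {z : Pt n m} (hz : z.1 ≠ 0) :
    DifferentiableAt ℝ (T f) z := by
  induction hT with
  | pure σ => exact smoothAlg.differentiable _ z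
  | term ha l σ _ _ _ _ =>
    exact ((ha.differentiableAt hz).comp z differentiableAt_fst).mul (smoothAlg.differentiable _ z)
  | add _ _ ihT ihU => exact ihT.add ihU

theorem fderiv_coef_mul {a : (Fin n → ℝ) → ℝ} {z : Pt n m} (ha : DifferentiableAt ℝ a z.1)
    (g : smoothAlg (Pt n m)) (v : Pt n m) :
    fderiv ℝ (fun z : Pt n m => a z.1 * (g : Pt n m → ℝ) z) z v =
      fderiv ℝ a z.1 v.1 * (g : Pt n m → ℝ) z + a z.1 * (dirEnd v g : Pt n m → ℝ) z := by
  have h1 : HasFDerivAt (fun z : Pt n m => a z.1)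
      ((fderiv ℝ a z.1).comp (ContinuousLinearMap.fst ℝ (Fin n → ℝ) (Fin m → ℝ))) z :=
    HasFDerivAt.comp z ha.hasFDerivAt hasFDerivAt_fst
  rw [(h1.fun_mul (smoothAlg.differentiable g z).hasFDerivAt).fderiv, dirEnd_apply, dirDeriv_apply]
  simp [mul_comm, add_comm]

theorem YForm.exists_dx {r s : ℕ} {T : smoothAlg (Pt n m) → Pt n m → ℝ}
    (hT : YForm n m N r s T) (j : Fin n) :
    ∃ U, YForm n m N r (s + 1) U ∧ ∀ f (z : Pt n m), z.1 ≠ 0 → Dx n m j (T f) z = U f z := by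
  induction hT with
  | pure σ => exact ⟨_, .pure (j :: σ), fun f z _ => rfl⟩
  | @term r s d a ha l σ hl hr hs hd =>
    obtain ⟨b, hb, hB⟩ := ha.exists_fderiv j
    refine ⟨_, .add (.term hb l σ hl hr (by omega) (by rw [hd]; push_cast; ring))
      (.term ha l (j :: σ) hl hr (by simpa using hs)
        (by rw [hd, List.length_cons]; push_cast; ring)), fun f z hz => ?_⟩
    rw [← xEnd_mul_yxEnd, ← hB _ hz]
    exact fderiv_coef_mul (ha.differentiableAt hz) _ _
  | add hT hU ihT ihU =>
    obtain ⟨T', hT', h⟩ := ihT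
    obtain ⟨U', hU', h'⟩ := ihU
    refine ⟨_, .add hT' hU', fun f z hz => ?_⟩
    rw [← h f z hz, ← h' f z hz, Dx,
      fderiv_fun_add (hT.differentiableAt f hz) (hU.differentiableAt f hz)]
    rfl

theorem YForm.exists_dy {r s : ℕ} {T : smoothAlg (Pt n m) → Pt n m → ℝ}
    (hT : YForm n m N r s T) (k : Fin m) :
    ∃ U, YForm n m N (r + 1) s U ∧
      ∀ f (z : Pt n m), z.1 ≠ 0 → rad z.1 ^ N * Dy n m k (T f) z = U f z := by
  induction hT with
  | pure σ =>
    refine ⟨_, .term (.radPow N) [k] σ (by simp) rfl le_rfl (by push_cast; ring),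
      fun f z _ => ?_⟩
    rw [zpow_natCast]
    simp only [yxEnd, List.map_cons, List.map_nil, List.prod_cons, List.prod_nil, mul_one]
    rfl
  | @term r s d a ha l σ hl hr hs hd =>
    refine ⟨_, .term (.mul rfl (.radPow N) ha) (k :: l) σ (by simp) (by simp [hr]) hs
      (by rw [hd]; push_cast; ring), fun f z hz => ?_⟩
    rw [← yEnd_mul_yxEnd, Dy, fderiv_coef_mul (ha.differentiableAt hz), zpow_natCast, map_zero,
      zero_mul, zero_add, mul_assoc]
    rfl
  | add hT hU ihT ihU =>
    obtain ⟨T', hT', h⟩ := ihT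
    obtain ⟨U', hU', h'⟩ := ihU
    refine ⟨_, .add hT' hU', fun f z hz => ?_⟩
    rw [← h f z hz, ← h' f z hz, Dy,
      fderiv_fun_add (hT.differentiableAt f hz) (hU.differentiableAt f hz), ← mul_add]
    rfl

theorem exists_YForm_eq (l : List (Fin n ⊕ Fin m)) :
    ∃ r s T, r + s = l.length ∧ YForm n m N r s T ∧
      ∀ (f : smoothAlg (Pt n m)) (z : Pt n m), z.1 ≠ 0 →
        compOps (l.map (Yop n m N)) f z = T f z := by
  induction l with
  | nil => exact ⟨0, 0, _, rfl, .pure [], fun f z _ => rfl⟩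
  | cons q l ih =>
    obtain ⟨r, s, T, hrs, hT, h⟩ := ih
    have hf : ∀ (f : smoothAlg (Pt n m)) (z : Pt n m), z.1 ≠ 0 →
        fderiv ℝ (compOps (l.map (Yop n m N)) f) z = fderiv ℝ (T f) z := fun f z hz =>
      Filter.EventuallyEq.fderiv_eq <|
        (continuous_fst.continuousAt.eventually_ne hz).mono fun w hw => h f w hw
    rcases q with j | k
    · obtain ⟨U, hU, hU'⟩ := hT.exists_dx j
      refine ⟨r, s + 1, U, by simp [← hrs, add_assoc], hU, fun f z hz => ?_⟩
      rw [← hU' f z hz, Dx, ← hf f z hz]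
      rfl
    · obtain ⟨U, hU, hU'⟩ := hT.exists_dy k
      refine ⟨r + 1, s, U, by simp [← hrs]; ring, hU, fun f z hz => ?_⟩
      rw [← hU' f z hz, Dy, ← hf f z hz]
      rfl

theorem YForm.exists_dominating {r s : ℕ} {T : smoothAlg (Pt n m) → Pt n m → ℝ}
    (hT : YForm n m N r s T) (hN : r + s ≤ N + 1) :
    ∃ L : List (Module.End ℝ (smoothAlg (Pt n m))), (∀ S ∈ L, S ∈ genSpan n m N ^ (r + s)) ∧
      ∀ f (z : Pt n m), z.1 ≠ 0 → |T f z| ≤ (L.map fun S => |(S f : Pt n m → ℝ) z|).sum := by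
  induction hT with
  | pure σ =>
    refine ⟨[(σ.map (xEnd m)).prod], fun S hS => ?_, fun f z _ => by simp⟩
    rw [List.mem_singleton.1 hS, zero_add]
    exact xEnd_prod_mem σ
  | @term r s d a ha l σ hl hr hs hd =>
    obtain ⟨C, hC0, hC⟩ := ha.exists_bound
    have hr1 : 1 ≤ r := hr ▸ List.length_pos_iff.2 hl
    obtain ⟨t, ht⟩ := Nat.exists_eq_add_of_le hs
    have htN : t ≤ r * N := (show t ≤ N by omega).trans (Nat.le_mul_of_pos_left N hr1)
    obtain ⟨e, he⟩ := Nat.exists_eq_add_of_le htN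
    have hde : d = e := by
      rw [hd, ht, ← Nat.cast_mul, he]
      push_cast
      ring
    refine ⟨List.ofFn fun i => (C * n ^ e) • (xMul m i ^ e * yxEnd l σ), fun S hS => ?_,
      fun f z hz => ?_⟩
    · obtain ⟨i, rfl⟩ := (List.mem_ofFn' _ _).1 hS
      have := xMul_pow_mul_yxEnd_mem (N := N) i hl σ (d := e) (t := t) (by omega)
        (by rw [hr, he, add_comm])
      rw [show l.length + t + σ.length = r + s by omega] at this
      exact Submodule.smul_mem _ _ this
    · obtain ⟨i, hi⟩ := exists_rad_le hz
      rw [List.map_ofFn, List.sum_ofFn]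
      refine le_trans ?_ (Finset.single_le_sum (fun i _ => abs_nonneg _) (Finset.mem_univ i))
      change _ ≤ |(C * n ^ e) * ((xMul m i ^ e) (yxEnd l σ f) : Pt n m → ℝ) z|
      rw [xMul_pow_apply, abs_mul, abs_mul, abs_mul (_ ^ e), ← mul_assoc]
      refine mul_le_mul_of_nonneg_right ((hC _ hz).trans ?_) (abs_nonneg _)
      rw [abs_of_nonneg (by positivity), hde, zpow_natCast, mul_assoc, abs_pow, ← mul_pow]
      exact mul_le_mul_of_nonneg_left (pow_le_pow_left₀ (rad_pos hz).le hi e) hC0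
  | add _ _ ihT ihU =>
    obtain ⟨L, hL, h⟩ := ihT hN
    obtain ⟨K, hK, h'⟩ := ihU hN
    refine ⟨L ++ K, fun S hS => (List.mem_append.1 hS).elim (hL S) (hK S), fun f z hz => ?_⟩
    rw [List.map_append, List.sum_append]
    exact (abs_add_le _ _).trans (add_le_add (h f z hz) (h' f z hz))

theorem exists_eLpNorm_sum_abs_le {M : ℕ} {p : ℝ≥0∞} (hp : 1 ≤ p)
    (L : List (Module.End ℝ (smoothAlg (Pt n m)))) (hL : ∀ S ∈ L, S ∈ genSpan n m N ^ M) :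
    ∃ C : ℝ≥0, ∀ f : smoothAlg (Pt n m),
      Continuous (fun z => (L.map fun S => |(S f : Pt n m → ℝ) z|).sum) ∧
      eLpNorm (fun z => (L.map fun S => |(S f : Pt n m → ℝ) z|).sum) p volume ≤
        C * ⨆ β : Fin M → XIdx n m N, eLpNorm (Xw β (f : Pt n m → ℝ)) p volume := by
  induction L with
  | nil => exact ⟨0, fun f => ⟨continuous_const, by simp⟩⟩
  | cons S L ih =>
    obtain ⟨C, hC⟩ := exists_eLpNorm_le_iSup_Xw (hL S (by simp)) hp
    obtain ⟨D, hD⟩ := ih fun S hS => hL S (by simp [hS])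
    refine ⟨C + D, fun f => ?_⟩
    simp only [List.map_cons, List.sum_cons]
    have hc : Continuous fun z => |(S f : Pt n m → ℝ) z| := (smoothAlg.contDiff (S f)).continuous.abs
    refine ⟨hc.add (hD f).1, ?_⟩
    rw [ENNReal.coe_add, add_mul]
    refine (eLpNorm_add_le hc.aestronglyMeasurable (hD f).1.aestronglyMeasurable hp).trans
      (add_le_add ?_ (hD f).2)
    exact (eLpNorm_norm (S f : Pt n m → ℝ)).trans_le (hC f)

theorem ae_fst_ne_zero (hn : 1 ≤ n) : ∀ᵐ z : Pt n m, z.1 ≠ 0 := by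
  have : Nonempty (Fin n) := ⟨⟨0, hn⟩⟩
  have hz : {z : Pt n m | ¬ z.1 ≠ 0} = {0} ×ˢ Set.univ := by
    ext z
    simp
  rw [ae_iff, hz, Measure.volume_eq_prod, Measure.prod_prod, measure_singleton, zero_mul]

theorem exists_eLpNorm_Yw_le {M : ℕ} (hn : 1 ≤ n) (hM : M ≤ N + 1) {p : ℝ≥0∞} (hp : 1 ≤ p)
    (α : Fin M → Fin n ⊕ Fin m) :
    ∃ C : ℝ≥0, ∀ f : smoothAlg (Pt n m), eLpNorm (Yw (N := N) α (f : Pt n m → ℝ)) p volume ≤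
      C * ⨆ β : Fin M → XIdx n m N, eLpNorm (Xw β (f : Pt n m → ℝ)) p volume := by
  obtain ⟨r, s, T, hrs, hT, h⟩ := exists_YForm_eq (N := N) (List.ofFn α)
  rw [List.length_ofFn] at hrs
  obtain ⟨L, hL, hLT⟩ := hT.exists_dominating (hrs.trans_le hM)
  rw [hrs] at hL
  obtain ⟨C, hC⟩ := exists_eLpNorm_sum_abs_le hp L hL
  refine ⟨C, fun f => (eLpNorm_mono_ae_real ?_).trans (hC f).2⟩
  filter_upwards [ae_fst_ne_zero hn] with z hz
  have := h f z hz
  rw [List.map_ofFn] at this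
  exact (congrArg abs this).trans_le (hLT f z hz)

end YWords

/-- (Comparison of `Y`-derivatives with `X`-derivatives up to order
`N+1`.)  For `n ≥ 2`, `m, N ≥ 1`, `1 ≤ M ≤ N+1`, `p ∈ (1,∞)`, there is `c > 0` such that
`‖Y^α φ‖_p ≤ c · max_{|β| = M} ‖X^β φ‖_p` for all `φ ∈ C_c^∞(ℝ^(n+m))` and all words
`α ∈ {1,…,n+m}^M`. -/
theorem Y_derivatives_dominated_by_X_derivatives
    (n m N : ℕ) (hn : 2 ≤ n) (hm : 1 ≤ m) (hN : 1 ≤ N)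
    (M : ℕ) (hM1 : 1 ≤ M) (hM2 : M ≤ N + 1) (p : ℝ) (hp : 1 < p) :
    ∃ c > (0 : ℝ), ∀ φ : Pt n m → ℝ, ContDiff ℝ (⊤ : ℕ∞) φ → HasCompactSupport φ →
      ∀ α : Fin M → (Fin n ⊕ Fin m),
        eLpNorm (Yw (N := N) α φ) (ENNReal.ofReal p) volume ≤
          ENNReal.ofReal c *
            ⨆ β : Fin M → XIdx n m N, eLpNorm (Xw β φ) (ENNReal.ofReal p) volume := by
  have hp' : 1 ≤ ENNReal.ofReal p := ENNReal.one_le_ofReal.2 hp.le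
  choose C hC using fun α : Fin M → Fin n ⊕ Fin m =>
    exists_eLpNorm_Yw_le (N := N) (one_le_two.trans hn) hM2 hp' α
  refine ⟨((1 + ∑ α, C α : ℝ≥0) : ℝ), by positivity, fun φ hφ _ α => ?_⟩
  rw [ENNReal.ofReal_coe_nnreal]
  refine (hC α ⟨φ, hφ⟩).trans (mul_le_mul_left (ENNReal.coe_le_coe.2 ?_) _)
  exact (Finset.single_le_sum (fun _ _ => zero_le) (Finset.mem_univ α)).trans le_add_self
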